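/- arXiv:1212.5503 — 2 statements merged into one kernel-verified Lean document; each statement's English description precedes it below -/
import Mathlib

section
/- Let E be an n-dimensional vector space over an arbitrary field and let A₁, …, A_k (with 0 < k ≤ n) be a degenerate family of nonempty finite subsets of E. Then there exist an integer p with 1 ≤ p ≤ k, a (p−1)-dimensional linear subspace H of E, and p distinct indices i₁, …, i_p ∈ {1, …, k} such that A_{i_j} ⊆ H for every j = 1, …, p. -/
open Module in
theorem rado_aux {K E ι : Type*} [Field K] [AddCommGroup E] [Module K E]
    [FiniteDimensional K E] [Fintype ι] (N : ℕ) : ∀ (A : ι → Finset E),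
    (∑ i, (A i).card = N) →
    (∀ S : Finset ι, S.card ≤ finrank K (Submodule.span K (⋃ i ∈ S, (A i : Set E)))) →
    ∃ a : ι → E, (∀ i, a i ∈ A i) ∧ LinearIndependent K a := by
  classical
  induction N using Nat.strong_induction_on with
  | _ N ih =>
  intro A hN hR
  by_cases hc : ∃ i, 1 < (A i).card
  · obtain ⟨i, hi⟩ := hc
    obtain ⟨x, hx, y, hy, hxy⟩ := Finset.one_lt_card.1 hi
    have step : ∀ z ∈ A i, (∃ a : ι → E, (∀ i, a i ∈ A i) ∧ LinearIndependent K a) ∨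
        ∃ S : Finset ι, i ∈ S ∧ ∃ U : Submodule K E, finrank K U < S.card ∧
          (∀ w ∈ A i, w ≠ z → w ∈ U) ∧ ∀ j ∈ S, j ≠ i → ∀ w ∈ A j, w ∈ U := by
      intro z hz
      by_cases h : ∀ S : Finset ι, S.card ≤ finrank K (Submodule.span K
          (⋃ j ∈ S, (Function.update A i ((A i).erase z) j : Set E)))
      · left
        have hlt : ∑ j, (Function.update A i ((A i).erase z) j).card < N := by
          rw [← hN]
          apply Finset.sum_lt_sum
          · intro j _
            by_cases hj : j = i
            · subst hj; simp [Finset.card_erase_le]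
            · simp [hj]
          · exact ⟨i, Finset.mem_univ _, by simpa using Finset.card_erase_lt_of_mem hz⟩
        obtain ⟨a, ha, hl⟩ := ih _ hlt _ rfl h
        refine ⟨a, fun j => ?_, hl⟩
        have := ha j
        by_cases hj : j = i
        · subst hj
          rw [Function.update_self] at this
          exact Finset.mem_of_mem_erase this
        · rwa [Function.update_of_ne hj] at this
      · right
        push Not at h
        obtain ⟨S, hS⟩ := h
        have hiS : i ∈ S := by
          by_contra hiS
          have h2 := hR S
          have : (⋃ j ∈ S, (Function.update A i ((A i).erase z) j : Set E))
              = ⋃ j ∈ S, (A j : Set E) := by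
            refine Set.iUnion₂_congr fun j hj => ?_
            rw [Function.update_of_ne (by rintro rfl; exact hiS hj)]
          rw [this] at hS
          omega
        refine ⟨S, hiS, _, hS, ?_, ?_⟩
        · intro w hw hwz
          apply Submodule.subset_span
          simp only [Set.mem_iUnion]
          exact ⟨i, hiS, by simp [hw, hwz]⟩
        · intro j hj hji w hw
          apply Submodule.subset_span
          simp only [Set.mem_iUnion]
          exact ⟨j, hj, by simp [hji, hw]⟩
    rcases step x hx with h | ⟨S, hiS, U, hU, hU1, hU2⟩
    · exact h
    rcases step y hy with h | ⟨T, hiT, V, hV, hV1, hV2⟩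
    · exact h
    exfalso
    have h1 : Submodule.span K (⋃ j ∈ S ∪ T, (A j : Set E)) ≤ U ⊔ V := by
      rw [Submodule.span_le]
      intro w hw
      simp only [Set.mem_iUnion] at hw
      obtain ⟨j, hj, hw⟩ := hw
      have hw : w ∈ A j := hw
      by_cases hji : j = i
      · subst hji
        by_cases hwx : w = x
        · exact Submodule.mem_sup_right (hV1 w hw (by rw [hwx]; exact hxy))
        · exact Submodule.mem_sup_left (hU1 w hw hwx)
      · rcases Finset.mem_union.1 hj with hj | hj
        · exact Submodule.mem_sup_left (hU2 j hj hji w hw)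
        · exact Submodule.mem_sup_right (hV2 j hj hji w hw)
    have h2 : Submodule.span K (⋃ j ∈ (S ∩ T).erase i, (A j : Set E)) ≤ U ⊓ V := by
      rw [Submodule.span_le]
      intro w hw
      simp only [Set.mem_iUnion] at hw
      obtain ⟨j, hj, hw⟩ := hw
      have hw : w ∈ A j := hw
      obtain ⟨hji, hj⟩ := Finset.mem_erase.1 hj
      obtain ⟨hjS, hjT⟩ := Finset.mem_inter.1 hj
      exact ⟨hU2 j hjS hji w hw, hV2 j hjT hji w hw⟩
    have h3 := (hR _).trans (Submodule.finrank_mono h1)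
    have h4 := (hR _).trans (Submodule.finrank_mono h2)
    have h5 := Submodule.finrank_sup_add_finrank_inf_eq U V
    have h6 := Finset.card_union_add_card_inter S T
    have h7 := Finset.card_erase_add_one (Finset.mem_inter.2 ⟨hiS, hiT⟩)
    omega
  · push Not at hc
    have h1 : ∀ i, ∃ a, A i = {a} := by
      intro i
      rw [← Finset.card_eq_one]
      refine le_antisymm (hc i) ?_
      by_contra h0
      have h0 : A i = ∅ := by rw [← Finset.card_eq_zero]; omega
      have := hR {i}
      simp [h0] at this
    choose a ha using h1
    refine ⟨a, fun i => by simp [ha], ?_⟩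
    rw [linearIndependent_iff_card_le_finrank_span]
    have := hR Finset.univ
    have h2 : (⋃ i ∈ (Finset.univ : Finset ι), (A i : Set E)) = Set.range a := by
      ext w; simp [ha, eq_comm]
    rw [h2] at this
    simpa [Set.finrank] using this

/-- If `A₁, …, A_k` (with `0 < k ≤ n = dim E`) is a degenerate family of
nonempty finite subsets of an `n`-dimensional vector space `E` over an arbitrary field
(i.e. every choice of vectors `aᵢ ∈ Aᵢ` is linearly dependent), then there exist
`1 ≤ p ≤ k`, a `(p-1)`-dimensional subspace `H` of `E`, and `p` distinct indices
`i₁, …, i_p` such that `A_{i_j} ⊆ H` for all `j`. -/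
theorem stmt0 {K E : Type*} [Field K] [AddCommGroup E] [Module K E]
    [FiniteDimensional K E] {n k : ℕ} (hn : Module.finrank K E = n)
    (hk : 0 < k) (hkn : k ≤ n)
    (A : Fin k → Finset E) (hA : ∀ i, (A i).Nonempty)
    (hdeg : ∀ a : Fin k → E, (∀ i, a i ∈ A i) → ¬ LinearIndependent K a) :
    ∃ p : ℕ, 1 ≤ p ∧ p ≤ k ∧
      ∃ H : Submodule K E, Module.finrank K H = p - 1 ∧
        ∃ ι : Fin p ↪ Fin k, ∀ j : Fin p, (A (ι j) : Set E) ⊆ (H : Set E) := by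
  by_contra hcon
  have hR : ∀ S : Finset (Fin k), S.card ≤
      Module.finrank K (Submodule.span K (⋃ i ∈ S, (A i : Set E))) := by
    intro S
    by_contra hS
    push Not at hS
    apply hcon
    have hSk : S.card ≤ k := by simpa using Finset.card_le_univ S
    refine ⟨S.card, by omega, hSk, ?_⟩
    obtain ⟨H, hH, hHr⟩ : ∃ H : Submodule K E,
        Submodule.span K (⋃ i ∈ S, (A i : Set E)) ≤ H ∧
        Module.finrank K H = S.card - 1 := by
      have key : ∀ (m : ℕ) (W : Submodule K E), Module.finrank K W + m ≤ n →
          ∃ H : Submodule K E, W ≤ H ∧ Module.finrank K H = Module.finrank K W + m := by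
        intro m
        induction m with
        | zero => intro W _; exact ⟨W, le_rfl, rfl⟩
        | succ m ih =>
          intro W hW
          obtain ⟨H, h1, h2⟩ := ih W (by omega)
          have hne : H ≠ ⊤ := by
            rintro rfl
            rw [finrank_top] at h2
            omega
          obtain ⟨v, -, hv⟩ := SetLike.exists_of_lt (lt_top_iff_ne_top.2 hne)
          refine ⟨H ⊔ Submodule.span K {v}, h1.trans le_sup_left, ?_⟩
          have h3 := Submodule.finrank_sup_add_finrank_inf_eq H (Submodule.span K {v})
          have hv0 : v ≠ 0 := by rintro rfl; exact hv H.zero_mem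
          have h4 : H ⊓ Submodule.span K {v} = ⊥ :=
            disjoint_iff.1 ((Submodule.disjoint_span_singleton' hv0).2 hv)
          rw [h4, finrank_bot, finrank_span_singleton hv0] at h3
          omega
      obtain ⟨H, h1, h2⟩ := key (S.card - 1 - Module.finrank K
        (Submodule.span K (⋃ i ∈ S, (A i : Set E)))) (Submodule.span K (⋃ i ∈ S, (A i : Set E))) (by omega)
      exact ⟨H, h1, by omega⟩
    refine ⟨H, hHr, (S.orderEmbOfFin rfl).toEmbedding, fun j w hw => ?_⟩
    apply hH
    apply Submodule.subset_span
    simp only [Set.mem_iUnion]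
    exact ⟨_, S.orderEmbOfFin_mem rfl j, hw⟩
  obtain ⟨a, ha, hl⟩ := rado_aux (K := K) _ A rfl hR
  exact hdeg a ha hl
end

section
/- Let P be the convex hull of a finite subset of n-dimensional Euclidean space, and assume P has nonempty interior. For a unit vector u, let F(u) = {x ∈ P : ⟨x, u⟩ = sup_{y ∈ P} ⟨y, u⟩} be the face of P with outward normal u. Then the set S of unit vectors u for which the (n−1)-dimensional Hausdorff measure μH^{n−1}(F(u)) is positive is finite, and ∑_{u ∈ S} μH^{n−1}(F(u)) • u = 0. -/
open MeasureTheory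
open scoped RealInnerProductSpace


def coneM {V : Type*} [SMul ℝ V] (E : Set V) : Set V :=
  {y | ∃ t : ℝ, 0 < t ∧ t ≤ 1 ∧ ∃ x ∈ E, y = t • x}

noncomputable def PhiM (m : ℕ) : (ℝ × EuclideanSpace ℝ (Fin m)) ≃ₗ[ℝ] EuclideanSpace ℝ (Fin (m+1)) :=
  ((LinearEquiv.refl ℝ ℝ).prodCongr (WithLp.linearEquiv 2 ℝ (Fin m → ℝ))) ≪≫ₗ
    (Fin.consLinearEquiv ℝ (fun _ : Fin (m+1) => ℝ)) ≪≫ₗ (WithLp.linearEquiv 2 ℝ (Fin (m+1) → ℝ)).symm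

lemma PhiM_zero (m : ℕ) (p : ℝ × EuclideanSpace ℝ (Fin m)) : PhiM m p 0 = p.1 := by
  simp [PhiM]

lemma PhiM_succ (m : ℕ) (p : ℝ × EuclideanSpace ℝ (Fin m)) (i : Fin m) :
    PhiM m p i.succ = p.2 i := by
  simp [PhiM]

lemma PhiM_iso (m : ℕ) (h : ℝ) : Isometry (fun e => PhiM m (h, e)) := by
  refine Isometry.of_dist_eq fun x y => ?_
  simp [EuclideanSpace.dist_eq, Fin.sum_univ_succ, PhiM_zero, PhiM_succ]

lemma lint_M (m : ℕ) (h : ℝ) (hh : 0 < h) :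
    ∫⁻ s in Set.Ioc 0 h, ENNReal.ofReal |((h / s) ^ m)⁻¹| = ENNReal.ofReal (h / (m+1)) := by
  have : ∫⁻ s in Set.Ioc 0 h, ENNReal.ofReal |((h / s) ^ m)⁻¹|
      = ∫⁻ s in Set.Ioc 0 h, ENNReal.ofReal ((s / h) ^ m) := by
    refine setLIntegral_congr_fun measurableSet_Ioc fun s hs => ?_
    have := hs.1
    show ENNReal.ofReal |((h / s) ^ m)⁻¹| = ENNReal.ofReal ((s / h) ^ m)
    rw [← inv_pow, inv_div, abs_of_nonneg (by positivity)]
  rw [this, ← ofReal_integral_eq_lintegral_ofReal]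
  · rw [← intervalIntegral.integral_of_le hh.le]
    congr 1
    simp only [div_pow]
    rw [intervalIntegral.integral_div, integral_pow]
    field_simp
    simp [pow_succ]
  · exact (Continuous.integrableOn_Ioc (by fun_prop))
  · refine (ae_restrict_iff' measurableSet_Ioc).2 (.of_forall fun s hs => ?_)
    have := hs.1
    simp only [Pi.zero_apply]
    positivity

lemma cone0M (m : ℕ) : ∃ c : ℝ, 0 < c ∧ ∀ (h : ℝ), 0 < h →
    ∀ E : Set (EuclideanSpace ℝ (Fin (m+1))), MeasurableSet E → (∀ x ∈ E, x 0 = h) →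
    MeasurableSet (coneM E) ∧ volume (coneM E) = ENNReal.ofReal (c * h) * μH[(m : ℝ)] E := by
  let Φ := (PhiM m).toContinuousLinearEquiv
  have : Measure.IsAddHaarMeasure (μH[(m : ℝ)] : Measure (EuclideanSpace ℝ (Fin m))) := by
    simpa using isAddHaarMeasure_hausdorffMeasure (E := EuclideanSpace ℝ (Fin m))
  let ν : Measure (ℝ × EuclideanSpace ℝ (Fin m)) := (volume : Measure ℝ).prod μH[(m : ℝ)]
  have : (ν.map Φ).IsAddHaarMeasure := Φ.isAddHaarMeasure_map ν
  set κ := (volume : Measure (EuclideanSpace ℝ (Fin (m+1)))).addHaarScalarFactor (ν.map Φ) with hκ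
  have hκ0 : 0 < κ := Measure.addHaarScalarFactor_pos_of_isAddHaarMeasure _ _
  have hvol : (volume : Measure (EuclideanSpace ℝ (Fin (m+1)))) = κ • (ν.map Φ) :=
    Measure.isAddLeftInvariant_eq_smul _ _
  refine ⟨κ / (m + 1), by positivity, fun h hh E hE hEh => ?_⟩
  have hcone : coneM E = {y | (0 < y 0 ∧ y 0 ≤ h) ∧ (h / y 0) • y ∈ E} := by
    ext y
    constructor
    · rintro ⟨t, ht, ht1, x, hx, rfl⟩
      have := hEh x hx
      simp only [Set.mem_ofPred_eq, PiLp.smul_apply, smul_eq_mul, this]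
      refine ⟨⟨by positivity, by nlinarith⟩, ?_⟩
      rw [smul_smul, div_mul_eq_mul_div, mul_comm, div_self (by positivity), one_smul]; exact hx
    · rintro ⟨⟨h1, h2⟩, h3⟩
      refine ⟨y 0 / h, by positivity, (div_le_one hh).2 h2, _, h3, ?_⟩
      rw [smul_smul, div_mul_div_comm, mul_comm, div_self (by positivity), one_smul]
  have hmeas : MeasurableSet (coneM E) := by
    rw [hcone]
    have h0 : Measurable fun y : EuclideanSpace ℝ (Fin (m+1)) => y 0 := by fun_prop
    refine ((measurableSet_lt measurable_const h0).inter (measurableSet_le h0 measurable_const)).inter ?_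
    exact hE.preimage ((measurable_const.div h0).smul measurable_id)
  refine ⟨hmeas, ?_⟩
  set E' : Set (EuclideanSpace ℝ (Fin m)) := (fun e => PhiM m (h, e)) ⁻¹' E with hE'
  have himg : (fun e => PhiM m (h, e)) '' E' = E := by
    rw [hE', Set.image_preimage_eq_iff]
    intro x hx
    obtain ⟨⟨s, e⟩, rfl⟩ := (PhiM m).surjective x
    have := hEh _ hx
    rw [PhiM_zero] at this
    simp only at this
    subst this
    exact ⟨e, rfl⟩
  have hEE : μH[(m : ℝ)] E = μH[(m : ℝ)] E' := by
    conv_lhs => rw [← himg]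
    exact (PhiM_iso m h).hausdorffMeasure_image (Or.inl (by positivity)) _
  rw [hvol, Measure.smul_apply, Measure.map_apply Φ.continuous.measurable hmeas,
    Measure.prod_apply (Φ.continuous.measurable hmeas)]
  have hslice : ∀ s : ℝ, μH[(m : ℝ)] (Prod.mk s ⁻¹' (Φ ⁻¹' coneM E)) =
      (Set.Ioc 0 h).indicator (fun s => ENNReal.ofReal |((h / s) ^ m)⁻¹| * μH[(m : ℝ)] E') s := by
    intro s
    by_cases hs : s ∈ Set.Ioc 0 h
    · rw [Set.indicator_of_mem hs]
      have : (Prod.mk s ⁻¹' (Φ ⁻¹' coneM E)) = (fun e => (h / s) • e) ⁻¹' E' := by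
        ext e
        have e1 : (PhiM m) (s, e) 0 = s := PhiM_zero _ _
        have e2 : (h, (h / s) • e) = (h / s) • (s, e) := by
          have := hs.1.ne'
          ext1 <;> simp [this]
        rw [hcone]
        show ((0 < (PhiM m) (s, e) 0 ∧ (PhiM m) (s, e) 0 ≤ h) ∧ (h / (PhiM m) (s, e) 0) • (PhiM m) (s, e) ∈ E) ↔ PhiM m (h, (h / s) • e) ∈ E
        rw [e1, e2, map_smul]
        exact ⟨fun H => H.2, fun H => ⟨hs, H⟩⟩
      rw [this, Measure.addHaar_preimage_smul _ (div_pos hh hs.1).ne']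
      simp
    · rw [Set.indicator_of_notMem hs]
      convert measure_empty (μ := (μH[(m : ℝ)] : Measure (EuclideanSpace ℝ (Fin m))))
      rw [Set.eq_empty_iff_forall_notMem]
      intro e he
      rw [hcone] at he
      have e1 : (PhiM m) (s, e) 0 = s := PhiM_zero _ _
      have := he.1
      change 0 < (PhiM m) (s, e) 0 ∧ (PhiM m) (s, e) 0 ≤ h at this
      rw [e1] at this
      exact hs this
  simp_rw [hslice]
  rw [lintegral_indicator measurableSet_Ioc, lintegral_mul_const _ (by fun_prop), lint_M m h hh, hEE]
  rw [ENNReal.smul_def, smul_eq_mul, ← mul_assoc, div_mul_eq_mul_div, mul_div_assoc,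
    ENNReal.ofReal_mul (NNReal.coe_nonneg κ)]
  simp

lemma coneM_map (m : ℕ) (f : EuclideanSpace ℝ (Fin m) ≃ₗᵢ[ℝ] EuclideanSpace ℝ (Fin m))
    (E : Set (EuclideanSpace ℝ (Fin m))) : f ⁻¹' coneM E = coneM (f ⁻¹' E) := by
  ext y
  constructor
  · rintro ⟨t, h1, h2, x, hx, h⟩
    refine ⟨t, h1, h2, f.symm x, by simpa using hx, ?_⟩
    apply f.injective
    simpa using h
  · rintro ⟨t, h1, h2, x, hx, rfl⟩
    exact ⟨t, h1, h2, f x, hx, by simp⟩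

lemma coneMeas (m : ℕ) : ∃ c : ℝ, 0 < c ∧ ∀ (u : EuclideanSpace ℝ (Fin (m+1))) (h : ℝ), ‖u‖ = 1 →
    0 < h → ∀ E : Set (EuclideanSpace ℝ (Fin (m+1))), MeasurableSet E → (∀ x ∈ E, ⟪x, u⟫ = h) →
    MeasurableSet (coneM E) ∧ volume (coneM E) = ENNReal.ofReal (c * h) * μH[(m : ℝ)] E := by
  obtain ⟨c, hc, H⟩ := cone0M m
  refine ⟨c, hc, fun u h hu hh E hE hEh => ?_⟩
  obtain ⟨b, hb⟩ := Orthonormal.exists_orthonormalBasis_extension_of_card_eq (𝕜 := ℝ)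
    (E := EuclideanSpace ℝ (Fin (m+1))) (ι := Fin (m+1)) (by simp) (v := fun _ => u) (s := {0})
    (by
      constructor
      · intro i; simpa using hu
      · intro i j hij; exact absurd (Subsingleton.elim i j) hij)
  have hb0 : b 0 = u := hb 0 rfl
  let f := b.repr.symm
  have hfE : MeasurableSet (f ⁻¹' E) := hE.preimage f.continuous.measurable
  obtain ⟨h1, h2⟩ := H h hh (f ⁻¹' E) hfE (by
    intro x hx
    have := hEh _ hx
    rw [← hb0, real_inner_comm, ← b.repr_apply_apply] at this
    simpa [f] using this)
  rw [← coneM_map] at h1 h2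
  have h3 : MeasurableSet (coneM E) := by
    have := h1.preimage b.repr.continuous.measurable
    rw [← Set.preimage_comp] at this
    convert this
    ext x
    simp [f]
  refine ⟨h3, ?_⟩
  rw [b.measurePreserving_repr_symm.measure_preimage h3.nullMeasurableSet] at h2
  rw [h2]
  congr 1
  exact f.toIsometryEquiv.hausdorffMeasure_preimage _ _

def faceM {m : ℕ} (P : Set (EuclideanSpace ℝ (Fin m))) (u : EuclideanSpace ℝ (Fin m)) :
    Set (EuclideanSpace ℝ (Fin m)) := {x ∈ P | ∀ y ∈ P, ⟪y, u⟫ ≤ ⟪x, u⟫}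

section
variable {m : ℕ}

lemma face_hull (A : Finset (EuclideanSpace ℝ (Fin m))) (u : EuclideanSpace ℝ (Fin m)) :
    faceM (convexHull ℝ (A : Set _)) u
      = convexHull ℝ ((A : Set _) ∩ faceM (convexHull ℝ (A : Set _)) u) := by
  classical
  apply Set.Subset.antisymm
  · intro x hx
    obtain ⟨w, hw0, hw1, hwx⟩ := Finset.mem_convexHull'.1 hx.1
    have hle : ∀ a ∈ A, ⟪a, u⟫ ≤ ⟪x, u⟫ := fun a ha => hx.2 a (subset_convexHull ℝ _ ha)
    have hsum : ∑ a ∈ A, w a * (⟪x, u⟫ - ⟪a, u⟫) = 0 := by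
      simp only [mul_sub, Finset.sum_sub_distrib]
      rw [← Finset.sum_mul, hw1, one_mul]
      conv_lhs => rw [← hwx]
      simp [sum_inner, inner_smul_left]
    rw [Finset.sum_eq_zero_iff_of_nonneg
      (fun a ha => mul_nonneg (hw0 a ha) (sub_nonneg.2 (hle a ha)))] at hsum
    have hne : ∀ a ∈ A, w a ≠ 0 → a ∈ faceM (convexHull ℝ (A : Set _)) u := by
      intro a ha hwa
      have : ⟪x, u⟫ = ⟪a, u⟫ := sub_eq_zero.1 ((mul_eq_zero.1 (hsum a ha)).resolve_left hwa)
      exact ⟨subset_convexHull ℝ _ ha, fun y hy => this ▸ hx.2 y hy⟩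
    have : ((A : Set _) ∩ faceM (convexHull ℝ (A : Set _)) u)
      = ((A.filter (fun a => a ∈ faceM (convexHull ℝ (A : Set _)) u) : Finset _) : Set _) := by
      ext a; simp
    rw [this, Finset.mem_convexHull']
    refine ⟨w, fun y hy => hw0 y (Finset.mem_filter.1 hy).1, ?_, ?_⟩
    · rw [Finset.sum_filter_of_ne hne, hw1]
    · rw [Finset.sum_filter_of_ne (fun a ha h => hne a ha (fun h0 => h (by rw [h0, zero_smul]))), hwx]
  · refine convexHull_min Set.inter_subset_right ?_
    intro x hx y hy a b ha hb hab
    refine ⟨convex_convexHull ℝ _ hx.1 hy.1 ha hb hab, fun z hz => ?_⟩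
    have h1 := hx.2 z hz
    have h2 := hy.2 z hz
    rw [inner_add_left, inner_smul_left, inner_smul_left]
    simp only [conj_trivial]
    calc ⟪z, u⟫ = a * ⟪z, u⟫ + b * ⟪z, u⟫ := by rw [← add_mul, hab, one_mul]
      _ ≤ _ := by gcongr

lemma faces_finite (A : Finset (EuclideanSpace ℝ (Fin m))) :
    (Set.range (faceM (convexHull ℝ (A : Set (EuclideanSpace ℝ (Fin m)))))).Finite := by
  refine ((A.finite_toSet.finite_subsets).image (fun B => convexHull ℝ B)).subset ?_
  rintro _ ⟨u, rfl⟩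
  exact ⟨_, Set.inter_subset_left, (face_hull A u).symm⟩

lemma face_closed {P : Set (EuclideanSpace ℝ (Fin m))} (hP : IsClosed P)
    (u : EuclideanSpace ℝ (Fin m)) : IsClosed (faceM P u) := by
  have : faceM P u = P ∩ ⋂ y ∈ P, {x | ⟪y, u⟫ ≤ ⟪x, u⟫} := by
    ext x; simp [faceM]
  rw [this]
  refine hP.inter (isClosed_biInter fun y _ => isClosed_le continuous_const (by fun_prop))

lemma face_support {P : Set (EuclideanSpace ℝ (Fin m))} (hP : IsClosed P) (hc : Convex ℝ P)
    (h0 : (interior P).Nonempty) {x : EuclideanSpace ℝ (Fin m)} (hx : x ∈ frontier P) :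
    ∃ u, ‖u‖ = 1 ∧ x ∈ faceM P u := by
  obtain ⟨f, hf⟩ := geometric_hahn_banach_open_point hc.interior isOpen_interior hx.2
  have hle : ∀ y ∈ P, f y ≤ f x := by
    intro y hy
    have hy' : y ∈ closure (interior P) := by
      rw [hc.closure_interior_eq_closure_of_nonempty_interior h0]; exact subset_closure hy
    exact closure_minimal (fun a ha => (hf a ha).le) (isClosed_le f.continuous continuous_const) hy'
  set v := (InnerProductSpace.toDual ℝ (EuclideanSpace ℝ (Fin m))).symm f with hv
  have hvf : ∀ y, f y = ⟪y, v⟫ := by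
    intro y
    rw [real_inner_comm, hv, InnerProductSpace.toDual_symm_apply]
  have hv0 : v ≠ 0 := by
    intro h
    obtain ⟨z, hz⟩ := h0
    have := hf z hz
    rw [hvf, hvf, h] at this
    simp at this
  have hvp : 0 < ‖v‖ := norm_pos_iff.2 hv0
  refine ⟨‖v‖⁻¹ • v, by simp [norm_smul, hvp.ne'], hP.frontier_subset hx, fun y hy => ?_⟩
  rw [inner_smul_right, inner_smul_right, ← hvf, ← hvf]
  exact mul_le_mul_of_nonneg_left (hle y hy) (by positivity)

lemma face_pos {P : Set (EuclideanSpace ℝ (Fin m))} (h0 : 0 ∈ interior P)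
    {u x : EuclideanSpace ℝ (Fin m)} (hu : ‖u‖ = 1) (hx : x ∈ faceM P u) : 0 < ⟪x, u⟫ := by
  obtain ⟨ε, hε, hb⟩ := Metric.mem_nhds_iff.1 (mem_interior_iff_mem_nhds.1 h0)
  have h1 : (ε / 2) • u ∈ P := hb (by
    rw [mem_ball_zero_iff, norm_smul, hu, Real.norm_of_nonneg (by positivity)]; linarith)
  have := hx.2 _ h1
  rw [inner_smul_left, real_inner_self_eq_norm_sq, hu] at this
  simp at this
  linarith

lemma face_nonempty {P : Set (EuclideanSpace ℝ (Fin m))} (hP : IsCompact P) (hne : P.Nonempty)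
    (u : EuclideanSpace ℝ (Fin m)) : (faceM P u).Nonempty := by
  obtain ⟨x, hx, hm⟩ := hP.exists_isMaxOn hne (f := fun y => ⟪y, u⟫) (by fun_prop)
  exact ⟨x, hx, fun y hy => hm hy⟩

lemma cone_cover {P : Set (EuclideanSpace ℝ (Fin m))} (hP : IsCompact P) (hc : Convex ℝ P)
    (h0 : 0 ∈ interior P) {y : EuclideanSpace ℝ (Fin m)} (hy : y ∈ P) (hy0 : y ≠ 0) :
    ∃ u, ‖u‖ = 1 ∧ y ∈ coneM (faceM P u) := by
  have hn : P ∈ nhds (0 : EuclideanSpace ℝ (Fin m)) := mem_interior_iff_mem_nhds.1 h0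
  have hg : 0 < gauge P y := (gauge_pos (absorbent_nhds_zero hn)
    (NormedSpace.isVonNBounded_iff ℝ |>.2 hP.isBounded)).2 hy0
  have hx : (gauge P y)⁻¹ • y ∈ frontier P := by
    rw [← gauge_eq_one_iff_mem_frontier hc hn, gauge_smul_of_nonneg (by positivity), smul_eq_mul,
      inv_mul_cancel₀ hg.ne']
  obtain ⟨u, hu, hxu⟩ := face_support hP.isClosed hc ⟨0, h0⟩ hx
  exact ⟨u, hu, gauge P y, hg, gauge_le_one_of_mem hy, _, hxu, by rw [smul_inv_smul₀ hg.ne']⟩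

lemma cone_disj {P : Set (EuclideanSpace ℝ (Fin m))}
    (h0 : 0 ∈ interior P) {u v : EuclideanSpace ℝ (Fin m)} (hu : ‖u‖ = 1) (hv : ‖v‖ = 1)
    (huv : u ≠ v) : AEDisjoint volume (coneM (faceM P u)) (coneM (faceM P v)) := by
  by_cases hne : (faceM P u).Nonempty ∧ (faceM P v).Nonempty
  · obtain ⟨⟨a, ha⟩, ⟨b, hb⟩⟩ := hne
    have hapos := face_pos h0 hu ha
    have hbpos := face_pos h0 hv hb
    set w := ⟪b, v⟫ • u - ⟪a, u⟫ • v with hw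
    have hw0 : w ≠ 0 := by
      intro h
      have h' : ⟪b, v⟫ • u = ⟪a, u⟫ • v := sub_eq_zero.1 h
      have hn := congrArg norm h'
      rw [norm_smul, norm_smul, hu, hv, Real.norm_of_nonneg hapos.le,
        Real.norm_of_nonneg hbpos.le, mul_one, mul_one] at hn
      rw [hn] at h'
      exact huv (smul_right_injective _ hapos.ne' h')
    refine measure_mono_null (t := ((ℝ ∙ w)ᗮ : Submodule ℝ _)) ?_
      (Measure.addHaar_submodule _ _ ?_)
    · rintro y ⟨⟨t, ht, -, x, hx, rfl⟩, ⟨s, hs, -, z, hz, hxz⟩⟩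
      have e1 : ⟪x, u⟫ = ⟪a, u⟫ := le_antisymm (ha.2 _ hx.1) (hx.2 _ ha.1)
      have e2 : ⟪z, v⟫ = ⟪b, v⟫ := le_antisymm (hb.2 _ hz.1) (hz.2 _ hb.1)
      have i1 : ⟪x, v⟫ ≤ ⟪b, v⟫ := hb.2 _ hx.1
      have i2 : ⟪z, u⟫ ≤ ⟪a, u⟫ := ha.2 _ hz.1
      have j1 : t * ⟪x, u⟫ = s * ⟪z, u⟫ := by
        have := congrArg (fun y => ⟪y, u⟫) hxz
        simpa [inner_smul_left] using this
      have j2 : t * ⟪x, v⟫ = s * ⟪z, v⟫ := by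
        have := congrArg (fun y => ⟪y, v⟫) hxz
        simpa [inner_smul_left] using this
      rw [e1] at j1
      rw [e2] at j2
      have k1 : t ≤ s := by
        have : t * ⟪a, u⟫ ≤ s * ⟪a, u⟫ := by rw [j1]; gcongr
        exact le_of_mul_le_mul_right this hapos
      have k2 : s ≤ t := by
        have : s * ⟪b, v⟫ ≤ t * ⟪b, v⟫ := by rw [← j2]; gcongr
        exact le_of_mul_le_mul_right this hbpos
      have k : s = t := le_antisymm k2 k1
      subst k
      have j3 : ⟪x, v⟫ = ⟪b, v⟫ := mul_left_cancel₀ hs.ne' j2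
      rw [SetLike.mem_coe, Submodule.mem_orthogonal_singleton_iff_inner_left, hw, inner_sub_right,
        inner_smul_right, inner_smul_right, inner_smul_left, inner_smul_left, e1, j3]
      simp; ring
    · intro htop
      have : w ∈ (ℝ ∙ w)ᗮ := htop ▸ Submodule.mem_top
      rw [Submodule.mem_orthogonal_singleton_iff_inner_left] at this
      exact hw0 (inner_self_eq_zero.1 this)
  · have : coneM (faceM P u) ∩ coneM (faceM P v) = ∅ := by
      rw [Set.eq_empty_iff_forall_notMem]
      rintro y ⟨⟨t, ht, -, x, hx, rfl⟩, ⟨s, hs, -, z, hz, hxz⟩⟩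
      exact hne ⟨⟨x, hx⟩, ⟨z, hz⟩⟩
    rw [AEDisjoint, this, measure_empty]

lemma main0 (c : ℝ) (hc : 0 < c)
    (H : ∀ (u : EuclideanSpace ℝ (Fin (m+1))) (h : ℝ), ‖u‖ = 1 →
    0 < h → ∀ E : Set (EuclideanSpace ℝ (Fin (m+1))), MeasurableSet E → (∀ x ∈ E, ⟪x, u⟫ = h) →
    MeasurableSet (coneM E) ∧ volume (coneM E) = ENNReal.ofReal (c * h) * μH[(m : ℝ)] E)
    (A : Finset (EuclideanSpace ℝ (Fin (m+1))))
    (P : Set (EuclideanSpace ℝ (Fin (m+1)))) (hP : P = convexHull ℝ (A : Set _))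
    (h0 : 0 ∈ interior P) (h : EuclideanSpace ℝ (Fin (m+1)) → ℝ)
    (hh : ∀ u, ∀ x ∈ faceM P u, ⟪x, u⟫ = h u) :
    ∃ hfin : {u | ‖u‖ = 1 ∧ 0 < μH[(m : ℝ)] (faceM P u)}.Finite,
      (volume P).toReal = ∑ u ∈ hfin.toFinset, c * h u * (μH[(m : ℝ)] (faceM P u)).toReal := by
  classical
  have hcomp : IsCompact P := by rw [hP]; exact A.finite_toSet.isCompact_convexHull (𝕜 := ℝ)
  have hconv : Convex ℝ P := by rw [hP]; exact convex_convexHull ℝ _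
  have hPne : P.Nonempty := ⟨0, interior_subset h0⟩
  have hpos : ∀ u, ‖u‖ = 1 → 0 < h u := by
    intro u hu
    obtain ⟨x, hx⟩ := face_nonempty hcomp hPne u
    rw [← hh u x hx]
    exact face_pos h0 hu hx
  have hcone : ∀ u, ‖u‖ = 1 → MeasurableSet (coneM (faceM P u)) ∧
      volume (coneM (faceM P u)) = ENNReal.ofReal (c * h u) * μH[(m : ℝ)] (faceM P u) :=
    fun u hu => H u (h u) hu (hpos u hu) _ (face_closed hcomp.isClosed u).measurableSet (hh u)
  have hrange : (Set.range (faceM P)).Finite := by rw [hP]; exact faces_finite A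
  have hfin : {u | ‖u‖ = 1 ∧ 0 < μH[(m : ℝ)] (faceM P u)}.Finite := by
    refine Set.Finite.of_finite_image (f := faceM P) (hrange.subset (Set.image_subset_range _ _)) ?_
    rintro u ⟨hu, hu'⟩ v ⟨hv, hv'⟩ huv
    by_contra hne
    have := cone_disj h0 hu hv hne
    rw [← huv, AEDisjoint, Set.inter_self, (hcone u hu).2] at this
    have h2 : ENNReal.ofReal (c * h u) ≠ 0 := by
      have := hpos u hu
      simp only [ne_eq, ENNReal.ofReal_eq_zero, not_le]
      positivity
    exact hu'.ne' ((mul_eq_zero.1 this).resolve_left h2)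
  refine ⟨hfin, ?_⟩
  obtain ⟨T, hTs, hT⟩ := Set.exists_subset_bijOn {u | ‖u‖ = 1} (faceM P)
  have hTfin : T.Finite := Set.Finite.of_finite_image
    (hrange.subset (Set.image_subset_range _ _)) hT.injOn
  set T' := hTfin.toFinset ∪ hfin.toFinset with hT'
  have hT'u : ∀ u ∈ T', ‖u‖ = 1 := by
    intro u hu
    rcases Finset.mem_union.1 hu with hu | hu
    · exact hTs (hTfin.mem_toFinset.1 hu)
    · exact (hfin.mem_toFinset.1 hu).1
  have hvol : volume P = volume (⋃ u ∈ T', coneM (faceM P u)) := by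
    apply le_antisymm
    · have : P ⊆ {0} ∪ ⋃ u ∈ T', coneM (faceM P u) := by
        intro y hy
        by_cases hy0 : y = 0
        · exact Or.inl hy0
        · right
          obtain ⟨u, hu, hyu⟩ := cone_cover hcomp hconv h0 hy hy0
          obtain ⟨v, hv, hvu⟩ := hT.surjOn (Set.mem_image_of_mem _ hu)
          refine Set.mem_biUnion (x := v) ?_ ?_
          · exact Finset.mem_coe.2 (Finset.mem_union_left _ (hTfin.mem_toFinset.2 hv))
          · rw [hvu]; exact hyu
      calc volume P ≤ _ := measure_mono this
        _ ≤ volume {0} + _ := measure_union_le _ _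
        _ = _ := by rw [measure_singleton, zero_add]
    · apply measure_mono
      refine Set.iUnion₂_subset fun u _ => ?_
      rintro y ⟨t, ht, ht1, x, hx, rfl⟩
      exact hconv.smul_mem_of_zero_mem (interior_subset h0) hx.1 ⟨ht.le, ht1⟩
  rw [hvol, measure_biUnion_finset₀
    (fun u hu v hv huv => cone_disj h0 (hT'u u hu) (hT'u v hv) huv)
    (fun u hu => (hcone u (hT'u u hu)).1.nullMeasurableSet), ENNReal.toReal_sum]
  · symm
    have : ∀ u ∈ T', (volume (coneM (faceM P u))).toReal
        = c * h u * (μH[(m : ℝ)] (faceM P u)).toReal := by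
      intro u hu
      have := hpos u (hT'u u hu)
      rw [(hcone u (hT'u u hu)).2, ENNReal.toReal_mul, ENNReal.toReal_ofReal (by positivity)]
    rw [Finset.sum_congr rfl this]
    refine Finset.sum_subset Finset.subset_union_right ?_
    intro u hu hu'
    have : μH[(m : ℝ)] (faceM P u) = 0 := by
      by_contra hne
      exact hu' (hfin.mem_toFinset.2 ⟨hT'u u hu, pos_iff_ne_zero.2 hne⟩)
    rw [this]; simp
  · intro u hu
    refine ne_top_of_le_ne_top hcomp.measure_lt_top.ne (measure_mono ?_)
    rintro y ⟨t, ht, ht1, x, hx, rfl⟩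
    exact hconv.smul_mem_of_zero_mem (interior_subset h0) hx.1 ⟨ht.le, ht1⟩

lemma face_translate (P : Set (EuclideanSpace ℝ (Fin m))) (p u : EuclideanSpace ℝ (Fin m)) :
    faceM ((fun x => x - p) '' P) u = (fun x => x - p) '' faceM P u := by
  ext x
  constructor
  · rintro ⟨⟨y, hy, rfl⟩, h⟩
    refine ⟨y, ⟨hy, fun z hz => ?_⟩, rfl⟩
    have := h _ ⟨z, hz, rfl⟩
    simp only [inner_sub_left] at this
    linarith
  · rintro ⟨y, ⟨hy, h⟩, rfl⟩
    refine ⟨⟨y, hy, rfl⟩, ?_⟩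
    rintro _ ⟨z, hz, rfl⟩
    have := h z hz
    simp only [inner_sub_left]
    linarith

lemma face_translate_meas (P : Set (EuclideanSpace ℝ (Fin m))) (p u : EuclideanSpace ℝ (Fin m))
    (d : ℝ) : μH[d] (faceM ((fun x => x - p) '' P) u) = μH[d] (faceM P u) := by
  rw [face_translate]
  exact (IsometryEquiv.subRight p).hausdorffMeasure_image _ _

lemma main1 (A : Finset (EuclideanSpace ℝ (Fin (m+1))))
    (P : Set (EuclideanSpace ℝ (Fin (m+1)))) (hP : P = convexHull ℝ (A : Set _))
    (hint : (interior P).Nonempty) :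
    ∃ hfin : {u | ‖u‖ = 1 ∧ 0 < μH[(m : ℝ)] (faceM P u)}.Finite,
      ∑ u ∈ hfin.toFinset, (μH[(m : ℝ)] (faceM P u)).toReal • u = 0 := by
  classical
  obtain ⟨c, hc, H⟩ := coneMeas m
  have hcomp : IsCompact P := by rw [hP]; exact A.finite_toSet.isCompact_convexHull (𝕜 := ℝ)
  choose g hg using face_nonempty hcomp (hint.mono interior_subset)
  have hh : ∀ u, ∀ x ∈ faceM P u, ⟪x, u⟫ = ⟪g u, u⟫ := fun u x hx =>
    le_antisymm ((hg u).2 _ hx.1) (hx.2 _ (hg u).1)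
  have key : ∀ p ∈ interior P, ∃ hfin : {u | ‖u‖ = 1 ∧ 0 < μH[(m : ℝ)] (faceM P u)}.Finite,
      (volume P).toReal = ∑ u ∈ hfin.toFinset,
        c * (⟪g u, u⟫ - ⟪p, u⟫) * (μH[(m : ℝ)] (faceM P u)).toReal := by
    intro p hp
    have himg : (fun x => x - p) '' P = convexHull ℝ ((A.image (fun x => x - p) : Finset _) : Set _) := by
      rw [hP, Finset.coe_image]
      have := AffineMap.image_convexHull ((AffineEquiv.vaddConst ℝ p).symm.toAffineMap) (A : Set (EuclideanSpace ℝ (Fin (m+1))))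
      exact this
    have hint0 : (0 : EuclideanSpace ℝ (Fin (m+1))) ∈ interior ((fun x => x - p) '' P) := by
      have := (Homeomorph.subRight p).image_interior P
      change (fun x => x - p) '' interior P = interior ((fun x => x - p) '' P) at this
      rw [← this]
      exact ⟨p, hp, sub_self p⟩
    have := main0 c hc H _ _ himg hint0 (fun u => ⟪g u, u⟫ - ⟪p, u⟫) (by
      intro u x hx
      rw [face_translate] at hx
      obtain ⟨y, hy, rfl⟩ := hx
      rw [inner_sub_left, hh u y hy])
    simp only [face_translate_meas] at this
    have hv : volume ((fun x => x - p) '' P) = volume P := by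
      simp only [sub_eq_add_neg]
      rw [Set.image_add_right, measure_preimage_add_right]
    rwa [hv] at this
  obtain ⟨p, hp⟩ := hint
  obtain ⟨hfin, hfp⟩ := key p hp
  refine ⟨hfin, ?_⟩
  set w := ∑ u ∈ hfin.toFinset, (μH[(m : ℝ)] (faceM P u)).toReal • u with hw
  obtain ⟨ε, hε, hq⟩ : ∃ ε : ℝ, 0 < ε ∧ p + ε • w ∈ interior P := by
    have hcont : Continuous (fun ε : ℝ => p + ε • w) := by fun_prop
    have : ∀ᶠ ε in nhds (0 : ℝ), p + ε • w ∈ interior P :=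
      hcont.continuousAt.eventually_mem (by simpa using isOpen_interior.mem_nhds hp)
    have h2 := (this.filter_mono nhdsWithin_le_nhds : ∀ᶠ ε in nhdsWithin (0 : ℝ) (Set.Ioi 0), _)
    obtain ⟨ε, h3, h4⟩ := (h2.and self_mem_nhdsWithin).exists
    exact ⟨ε, h4, h3⟩
  obtain ⟨_, hfq⟩ := key _ hq
  have hsub := hfp.symm.trans hfq
  rw [← sub_eq_zero, ← Finset.sum_sub_distrib] at hsub
  have : ∑ u ∈ hfin.toFinset, (c * (⟪g u, u⟫ - ⟪p, u⟫) * (μH[(m : ℝ)] (faceM P u)).toReal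
      - c * (⟪g u, u⟫ - ⟪p + ε • w, u⟫) * (μH[(m : ℝ)] (faceM P u)).toReal) = c * ε * ⟪w, w⟫ := by
    conv_rhs => rw [hw, inner_sum, ← hw, Finset.mul_sum]
    refine Finset.sum_congr rfl fun u _ => ?_
    rw [inner_add_left, inner_smul_left, inner_smul_right]
    simp only [conj_trivial]
    ring
  rw [this] at hsub
  exact inner_self_eq_zero.1 ((mul_eq_zero.1 hsub).resolve_left (by positivity))

end

/-- Minkowski relation / "Pascal conditions": let `P` be the convex hull
of a finite subset of `ℝ^n` with nonempty interior, and for a unit vector `u` let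
`F(u)` be the face of `P` with outward normal `u`. Then the set `S` of unit vectors `u`
with `μH^{n-1}(F(u)) > 0` is finite and `∑_{u ∈ S} μH^{n-1}(F(u)) • u = 0`. -/
theorem stmt6 {n : ℕ} (A : Finset (EuclideanSpace ℝ (Fin n)))
    (P : Set (EuclideanSpace ℝ (Fin n))) (hP : P = convexHull ℝ (A : Set _))
    (hint : (interior P).Nonempty)
    (Face : EuclideanSpace ℝ (Fin n) → Set (EuclideanSpace ℝ (Fin n)))
    (hFace : ∀ u, Face u = {x ∈ P | ∀ y ∈ P, ⟪y, u⟫ ≤ ⟪x, u⟫})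
    (S : Set (EuclideanSpace ℝ (Fin n)))
    (hS : S = {u | ‖u‖ = 1 ∧ 0 < μH[(n : ℝ) - 1] (Face u)}) :
    ∃ hfin : S.Finite,
      ∑ u ∈ hfin.toFinset, (μH[(n : ℝ) - 1] (Face u)).toReal • u = 0 := by
  obtain rfl : Face = faceM P := funext hFace
  subst hS
  cases n with
  | zero => exact ⟨Set.toFinite _, Subsingleton.elim _ _⟩
  | succ m =>
    have hm : (((m + 1 : ℕ) : ℝ) - 1) = m := by push_cast; ring
    simp only [hm]
    exact main1 A P hP hint
end
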